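/- There exists no antiunitary operator J on ℂ² such that J ∘ J = −id and J ∘ γ = γ ∘ J, where γ = diag(1, −1) is the 2×2 grading matrix. (In other words, the two-point space finite spectral triple with Hilbert space ℂ² and grading diag(1, −1) cannot have a real structure in KO-dimension 4, where the signs are ε = −1 and ε'' = 1.) -/

import Mathlib

open Matrix

/-- The two-point space finite spectral triple, with Hilbert space `ℂ²` and grading
`γ = diag(1, -1)`, cannot have a real structure in KO-dimension 4: there is no
antiunitary operator `J` on `ℂ²` with `J² = -id` and `Jγ = γJ`. -/
theorem two_point_space_no_real_structure_KO_dim_four :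
    ¬ ∃ J : (Fin 2 → ℂ) → (Fin 2 → ℂ),
      (∀ x y, J (x + y) = J x + J y) ∧
      (∀ (c : ℂ) (x : Fin 2 → ℂ), J (c • x) = (starRingEnd ℂ c) • J x) ∧
      Function.Bijective J ∧
      (∀ x y : Fin 2 → ℂ, star (J x) ⬝ᵥ J y = star y ⬝ᵥ x) ∧
      (∀ x, J (J x) = -x) ∧
      (∀ x, J ((Matrix.diagonal ![1, -1] : Matrix (Fin 2) (Fin 2) ℂ).mulVec x) =
        (Matrix.diagonal ![1, -1] : Matrix (Fin 2) (Fin 2) ℂ).mulVec (J x)) := by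
  rintro ⟨J, -, hsmul, -, -, hsq, hγ⟩
  have hfix : (Matrix.diagonal ![1, -1] : Matrix (Fin 2) (Fin 2) ℂ).mulVec ![1, 0] = ![1, 0] := by
    ext i
    fin_cases i <;> simp [Matrix.mulVec_diagonal]
  have hzero : J ![1, 0] 1 = 0 := by
    have h := congrFun (hγ ![1, 0]) 1
    rw [hfix, Matrix.mulVec_diagonal] at h
    simpa [self_eq_neg] using h
  have hline : J ![1, 0] = J ![1, 0] 0 • ![1, 0] := by
    ext i
    fin_cases i <;> simp [hzero]
  have hnorm : starRingEnd ℂ (J ![1, 0] 0) * J ![1, 0] 0 = -1 := by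
    have h := hsq ![1, 0]
    rw [hline, hsmul] at h
    simpa using congrFun h 0
  rw [← Complex.normSq_eq_conj_mul_self] at hnorm
  have hre : Complex.normSq (J ![1, 0] 0) = -1 := by exact_mod_cast hnorm
  linarith [Complex.normSq_nonneg (J ![1, 0] 0)]
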